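/- Let m⃗ be a singular vector with T(m⃗) = Σ_k Θ^k Σ_I η_I ⊗ v_{I,k} as in the CK_6 setting. Then the eigenvalue equations from conditions S2 for L = j and S2/S3 for L = ijk force: t.v_{∅,1} = 6 v_{∅,1} and t.v_{∅,1} = 4 v_{∅,1}, hence v_{∅,1} = 0; similarly t.v_{∅,0} = 5 v_{∅,0} = 4 v_{∅,0} gives v_{∅,0} = 0, and t.v_{∅,2} = 7 v_{∅,2} = 4 v_{∅,2} gives v_{∅,2} = 0. -/

import Mathlib

/-!
STATEMENT 18: let `m⃗` be a singular vector with `T(m⃗) = Σ_k Θᵏ Σ_I η_I ⊗ v_{I,k}`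
in the `CK₆` setting. The eigenvalue equations extracted (as coefficients of `η_j`,
resp. `η_{ijk}`) from the singular-vector conditions S2 for `L = j` and S2/S3 for
`L = ijk` force: `t.v_{∅,1} = 6 v_{∅,1}` and `t.v_{∅,1} = 4 v_{∅,1}`, hence
`v_{∅,1} = 0`; similarly `t.v_{∅,0} = 5 v_{∅,0} = 4 v_{∅,0}` gives `v_{∅,0} = 0`,
and `t.v_{∅,2} = 7 v_{∅,2} = 4 v_{∅,2}` gives `v_{∅,2} = 0`.

The setting is encoded exactly as in STATEMENT 16/17: `Ind(F) ≅ ℂ[Θ] ⊗ Λ(6) ⊗ F`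
as finitely supported functions on `ℕ × Finset (Fin 6)` valued in `F`, `T` the
Hodge-duality isomorphism, singularity expressed by conditions S1–S3 via the dual
λ-action of Proposition `actiondualck6`; `v_{∅,k} = (T m⃗) (k, ∅)` and `t` acts on
`F` by `tact`.
-/

open Finset in
/-- Koszul inversion count. -/
def invCount (s u : Finset (Fin 6)) : ℕ :=
  ((s ×ˢ u).filter fun p => p.2 < p.1).card

/-- the Grassmann algebra `Λ(6)` (equivalently, the span of the `η`-monomials),
with basis indexed by `Finset (Fin 6)`. -/
abbrev E6 := Finset (Fin 6) →₀ ℂ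

/-- the signed (Grassmann) product. -/
noncomputable def emul (x y : E6) : E6 :=
  x.sum fun s a => y.sum fun u b =>
    if Disjoint s u then Finsupp.single (s ∪ u) (a * b * (-1 : ℂ) ^ invCount s u) else 0

/-- the basis monomial `ξ_s` (equivalently `η_s`). -/
noncomputable def xiF (s : Finset (Fin 6)) : E6 := Finsupp.single s 1

/-- the odd derivation `∂_i`. -/
noncomputable def dE (i : Fin 6) (x : E6) : E6 :=
  x.sum fun s a =>
    if i ∈ s then
      Finsupp.single (s.erase i) (a * (-1 : ℂ) ^ (s.filter (· < i)).card)
    else 0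

variable {F : Type*} [AddCommGroup F] [Module ℂ F]

/-- `Ind(F) ≅ ℂ[Θ] ⊗ Λ(6) ⊗ F`: the vector `Σ Θᵏ η_I ⊗ v_{I,k}` is encoded by
`(k, I) ↦ v_{I,k}`. -/
abbrev IndF (F : Type*) [AddCommGroup F] [Module ℂ F] := (ℕ × Finset (Fin 6)) →₀ F

/-- `e ⊗ v` placed at `Θ`-degree `k`, for `e ∈ Λ(6)`. -/
noncomputable def emb (e : E6) (k : ℕ) (v : F) : IndF F :=
  e.sum fun s c => Finsupp.single (k, s) (c • v)

/-- multiplication by `Θᵐ`. -/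
noncomputable def shiftTheta (m : ℕ) (x : IndF F) : IndF F :=
  Finsupp.mapDomain (fun q => (q.1 + m, q.2)) x

/-- the sign of Proposition `actiondualck6`: `(-1)^{|L|(|L|+1)/2 + |L||I|}`. -/
noncomputable def sgnLI (L I : Finset (Fin 6)) : ℂ :=
  (-1 : ℂ) ^ (L.card * (L.card + 1) / 2 + L.card * I.card)

/-- coefficient of `λ⁰` in `T ∘ (ξ_L)_λ ∘ T⁻¹` applied to `η_I ⊗ v` (Proposition
`actiondualck6`):
`sgn • [ (|L|-2) Θ (ξ_L ⋆ η_I) ⊗ v - (-1)^{|L|} Σᵢ (∂ᵢξ_L ⋆ ∂ᵢη_I) ⊗ v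
  - Σ_{r<s} (∂_{rs}ξ_L ⋆ η_I) ⊗ ξ_{sr}.v ]`. -/
noncomputable def dualCoef0 (xact : Fin 6 → Fin 6 → Module.End ℂ F)
    (L I : Finset (Fin 6)) (v : F) : IndF F :=
  sgnLI L I •
    ( ((L.card : ℂ) - 2) • emb (emul (xiF L) (xiF I)) 1 v
      - ((-1 : ℂ) ^ L.card) •
          ∑ i : Fin 6, emb (emul (dE i (xiF L)) (dE i (xiF I))) 0 v
      - ∑ r : Fin 6, ∑ s : Fin 6,
          if r < s then emb (emul (dE r (dE s (xiF L))) (xiF I)) 0 (xact s r v) else 0 )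

/-- coefficient of `λ¹`:
`sgn • [ (ξ_L ⋆ η_I) ⊗ t.v - (-1)^{|L|} Σᵢ ∂ᵢ(ξ_{Li} ⋆ η_I) ⊗ v
  + (-1)^{|L|} Σ_{i≠j} (∂ᵢξ_{Lj} ⋆ η_I) ⊗ ξ_{ji}.v ]`. -/
noncomputable def dualCoef1 (tact : Module.End ℂ F)
    (xact : Fin 6 → Fin 6 → Module.End ℂ F)
    (L I : Finset (Fin 6)) (v : F) : IndF F :=
  sgnLI L I •
    ( emb (emul (xiF L) (xiF I)) 0 (tact v)
      - ((-1 : ℂ) ^ L.card) •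
          ∑ i : Fin 6, emb (dE i (emul (emul (xiF L) (xiF {i})) (xiF I))) 0 v
      + ((-1 : ℂ) ^ L.card) •
          ∑ i : Fin 6, ∑ j : Fin 6,
            if i ≠ j then emb (emul (dE i (emul (xiF L) (xiF {j}))) (xiF I)) 0 (xact j i v)
            else 0 )

/-- coefficient of `λ²`: `sgn • [ - Σ_{i<j} (ξ_{Lij} ⋆ η_I) ⊗ ξ_{ji}.v ]`. -/
noncomputable def dualCoef2 (xact : Fin 6 → Fin 6 → Module.End ℂ F)
    (L I : Finset (Fin 6)) (v : F) : IndF F :=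
  sgnLI L I •
    ( - ∑ i : Fin 6, ∑ j : Fin 6,
        if i < j then
          emb (emul (emul (emul (xiF L) (xiF {i})) (xiF {j})) (xiF I)) 0 (xact j i v)
        else 0 )

/-- the three λ-coefficients above, bundled. -/
noncomputable def dualCoef (tact : Module.End ℂ F)
    (xact : Fin 6 → Fin 6 → Module.End ℂ F)
    (d : ℕ) (L I : Finset (Fin 6)) (v : F) : IndF F :=
  if d = 0 then dualCoef0 xact L I v
  else if d = 1 then dualCoef1 tact xact L I v
  else if d = 2 then dualCoef2 xact L I v
  else 0

/-- the coefficient of `λᵖ` in `T ∘ (ξ_L)_λ ∘ T⁻¹` applied to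
`w = Σ Θᵏ η_I ⊗ v_{I,k}`, using Proposition `actiondualck6` together with
Lemma `lambda+thetack6`: `(ξ_L)_λ (Θᵏ ξ_I ⊗ v) = (Θ+λ)ᵏ ((ξ_L)_λ (ξ_I ⊗ v))`. -/
noncomputable def dualAct (tact : Module.End ℂ F)
    (xact : Fin 6 → Fin 6 → Module.End ℂ F)
    (L : Finset (Fin 6)) (w : IndF F) (p : ℕ) : IndF F :=
  w.sum fun kI v =>
    ∑ d ∈ Finset.range 3,
      if d ≤ p ∧ p - d ≤ kI.1 then
        (kI.1.choose (p - d) : ℂ) •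
          shiftTheta (kI.1 - (p - d)) (dualCoef tact xact d L kI.2 v)
      else 0

/-- the coefficient of `λᵖ` in
`T((ξ_L)_λ m) - i (-1)^{|L|(|L|+1)/2} λ^{3-|L|} T((ξ_L^*)_λ m)` (for `|L| ≤ 3`),
where `w = T(m)` and `ξ_L^* = (-1)^{invCount L Lᶜ} ξ_{Lᶜ}` is the modified Hodge dual. -/
noncomputable def singCond (tact : Module.End ℂ F)
    (xact : Fin 6 → Fin 6 → Module.End ℂ F)
    (L : Finset (Fin 6)) (w : IndF F) (p : ℕ) : IndF F :=
  dualAct tact xact L w p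
    - (Complex.I * (-1 : ℂ) ^ (L.card * (L.card + 1) / 2) *
        (-1 : ℂ) ^ invCount L Lᶜ) •
      (if 3 - L.card ≤ p then dualAct tact xact Lᶜ w (p - (3 - L.card)) else 0)

/-- `m` (with `w = T(m)`) is a singular vector: conditions S1, S2, S3. -/
def IsSingular (tact : Module.End ℂ F)
    (xact : Fin 6 → Fin 6 → Module.End ℂ F) (w : IndF F) : Prop :=
  ∀ L : Finset (Fin 6), L.card ≤ 3 →
    -- S1 (`0 ≤ |L| ≤ 3`): the second `λ`-derivative vanishes:
    (∀ p : ℕ, 2 ≤ p → singCond tact xact L w p = 0) ∧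
    -- S2 (`1 ≤ |L| ≤ 3`): the first `λ`-derivative at `λ = 0` vanishes:
    (1 ≤ L.card → singCond tact xact L w 1 = 0) ∧
    -- S3 (`|L| = 3`): the value at `λ = 0` vanishes:
    (L.card = 3 → singCond tact xact L w 0 = 0)

/-- the Hodge-duality isomorphism `T : Θᵏ η_I ⊗ v ↦ Θᵏ η̄_I ⊗ v`,
`η̄_I = (-1)^{invCount Iᶜ I} η_{Iᶜ}`. -/
noncomputable def Tmap (m : IndF F) : IndF F :=
  m.sum fun q v => Finsupp.single (q.1, q.2ᶜ) (((-1 : ℂ) ^ invCount q.2ᶜ q.2) • v)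

/-- the hypotheses making `F` a finite-dimensional irreducible `g_{≥0} = g₀ ⊕ g_{>0}`-module
with `g_{>0}` acting trivially: `tact` is the action of the grading element `t` and
`xact i j` that of `ξ_{ij} ∈ so(6)`. -/
structure IsG0Module (F : Type*) [AddCommGroup F] [Module ℂ F]
    (tact : Module.End ℂ F) (xact : Fin 6 → Fin 6 → Module.End ℂ F) : Prop where
  finiteDim : FiniteDimensional ℂ F
  skew : ∀ i j : Fin 6, xact i j = -xact j i
  t_central : ∀ i j : Fin 6, tact * xact i j = xact i j * tact
  so6_rel : ∀ a b c d : Fin 6,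
    xact a b * xact c d - xact c d * xact a b =
      (if a = c then xact b d else 0) - (if a = d then xact b c else 0)
        - (if b = c then xact a d else 0) + (if b = d then xact a c else 0)
  irreducible : ∀ W : Submodule ℂ F,
    (∀ v ∈ W, tact v ∈ W) → (∀ i j : Fin 6, ∀ v ∈ W, xact i j v ∈ W) → W = ⊥ ∨ W = ⊤
  nontriv : Nontrivial F

lemma emul_single_single (s u : Finset (Fin 6)) (a b : ℂ) :
    emul (Finsupp.single s a) (Finsupp.single u b) =
      if Disjoint s u then Finsupp.single (s ∪ u) (a * b * (-1 : ℂ) ^ invCount s u) else 0 := by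
  rw [emul, Finsupp.sum_single_index, Finsupp.sum_single_index] <;> simp

lemma emul_single_xiF (s u : Finset (Fin 6)) (a : ℂ) :
    emul (Finsupp.single s a) (xiF u) =
      if Disjoint s u then Finsupp.single (s ∪ u) (a * (-1 : ℂ) ^ invCount s u) else 0 := by
  rw [xiF, emul_single_single, mul_one]

lemma emul_xiF (s u : Finset (Fin 6)) :
    emul (xiF s) (xiF u) =
      if Disjoint s u then Finsupp.single (s ∪ u) ((-1 : ℂ) ^ invCount s u) else 0 := by
  rw [xiF, emul_single_xiF, one_mul]

lemma emul_zero_left (y : E6) : emul 0 y = 0 := by simp [emul]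

lemma emul_zero_right (x : E6) : emul x 0 = 0 := by simp [emul]

lemma dE_single (i : Fin 6) (s : Finset (Fin 6)) (a : ℂ) :
    dE i (Finsupp.single s a) =
      if i ∈ s then Finsupp.single (s.erase i) (a * (-1 : ℂ) ^ (s.filter (· < i)).card)
      else 0 := by
  simp [dE]

lemma dE_zero (i : Fin 6) : dE i 0 = 0 := by simp [dE]

lemma emb_apply (e : E6) (k n : ℕ) (S : Finset (Fin 6)) (v : F) :
    emb e k v (n, S) = if k = n then e S • v else 0 := by
  classical
  rw [emb, Finsupp.sum_apply, Finsupp.sum]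
  by_cases hk : k = n
  · subst hk
    rw [if_pos rfl, Finset.sum_eq_single S]
    · simp
    · intro b _ hb
      simp [hb]
    · intro h
      simp [Finsupp.notMem_support_iff.mp h]
  · rw [if_neg hk]
    exact Finset.sum_eq_zero fun b _ => by simp [hk]

lemma shiftTheta_apply (m n : ℕ) (S : Finset (Fin 6)) (x : IndF F) :
    shiftTheta m x (n, S) = if m ≤ n then x (n - m, S) else 0 := by
  have hinj : Function.Injective fun q : ℕ × Finset (Fin 6) => (q.1 + m, q.2) := by
    rintro ⟨a, b⟩ ⟨c, d⟩ h
    simpa using h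
  split_ifs with h
  · have := Finsupp.mapDomain_apply hinj x (n - m, S)
    simpa [shiftTheta, Nat.sub_add_cancel h] using this
  · refine Finsupp.mapDomain_of_notMem_range x _ ?_
    rintro ⟨⟨a, b⟩, hab⟩
    simp only [Prod.mk.injEq] at hab
    omega

lemma emul_xiF_apply_self (L I : Finset (Fin 6)) :
    emul (xiF L) (xiF I) L = if I = ∅ then 1 else 0 := by
  rw [emul_xiF]
  by_cases hI : I = ∅
  · simp [hI, invCount]
  · rw [if_neg hI]
    split_ifs with hd
    · rw [Finsupp.single_apply, if_neg]
      intro h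
      refine hI (Finset.disjoint_self_iff_empty I |>.mp (hd.mono_left ?_))
      exact Finset.union_eq_left.mp h
    · rfl

lemma emul_xiF_apply_of_not_subset {L S : Finset (Fin 6)} (h : ¬ L ⊆ S) (I : Finset (Fin 6)) :
    emul (xiF L) (xiF I) S = 0 := by
  rw [emul_xiF]
  split_ifs with hd
  · rw [Finsupp.single_apply, if_neg]
    rintro rfl
    exact h Finset.subset_union_left
  · rfl

lemma invCount_singleton_add_card_filter_lt {L : Finset (Fin 6)} {i : Fin 6} (hi : i ∉ L) :
    invCount L {i} + ((L ∪ {i}).filter (· < i)).card = L.card := by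
  have h1 : invCount L {i} = (L.filter fun l => ¬ l < i).card := by
    rw [invCount, Finset.product_singleton, Finset.filter_map, Finset.card_map]
    congr 1
    refine Finset.filter_congr fun l hl => ?_
    have : l ≠ i := fun h => hi (h ▸ hl)
    simp only [Function.comp_apply, Function.Embedding.coeFn_mk]
    omega
  have h2 : (L ∪ {i}).filter (· < i) = L.filter (· < i) := by
    rw [Finset.filter_union, Finset.filter_singleton]
    simp
  rw [h1, h2, add_comm, Finset.card_filter_add_card_filter_not]

/-- The terms `∂ᵢ(ξ_{Li} ⋆ η_I)`. -/
lemma dE_emul_emul (L I : Finset (Fin 6)) (i : Fin 6) :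
    dE i (emul (emul (xiF L) (xiF {i})) (xiF I)) =
      if i ∉ L ∧ Disjoint (L ∪ {i}) I then
        Finsupp.single ((L ∪ {i} ∪ I).erase i)
          ((-1 : ℂ) ^ invCount L {i} * (-1 : ℂ) ^ invCount (L ∪ {i}) I *
            (-1 : ℂ) ^ ((L ∪ {i} ∪ I).filter (· < i)).card)
      else 0 := by
  rw [emul_xiF]
  by_cases hi : i ∈ L
  · simp [hi, emul_zero_left, dE_zero]
  · rw [if_pos (Finset.disjoint_singleton_right.mpr hi), emul_single_xiF]
    by_cases hd : Disjoint (L ∪ {i}) I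
    · rw [if_pos hd, if_pos ⟨hi, hd⟩, dE_single, if_pos (by simp)]
    · rw [if_neg hd, if_neg (fun h => hd h.2), dE_zero]

lemma dE_emul_emul_apply_self (L I : Finset (Fin 6)) (i : Fin 6) :
    dE i (emul (emul (xiF L) (xiF {i})) (xiF I)) L =
      if I = ∅ then (if i ∈ L then 0 else (-1 : ℂ) ^ L.card) else 0 := by
  rw [dE_emul_emul]
  by_cases hI : I = ∅
  · subst hI
    by_cases hi : i ∈ L
    · simp [hi]
    · have he : (L ∪ {i}).erase i = L := by
        rw [Finset.union_comm, ← Finset.insert_eq, Finset.erase_insert hi]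
      rw [if_pos ⟨hi, Finset.disjoint_empty_right _⟩, if_pos rfl, if_neg hi,
        Finset.union_empty, he, Finsupp.single_eq_same,
        ← invCount_singleton_add_card_filter_lt hi, pow_add]
      simp [invCount]
  · rw [if_neg hI]
    split_ifs with h
    · rw [Finsupp.single_apply, if_neg]
      intro he
      obtain ⟨x, hx⟩ := Finset.nonempty_iff_ne_empty.mpr hI
      have hxL : x ∉ L ∪ {i} := Finset.disjoint_right.mp h.2 hx
      simp only [Finset.mem_union, Finset.mem_singleton, not_or] at hxL
      refine hxL.1 (he ▸ ?_)
      simp [hx, hxL.2]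
    · rfl

lemma dE_emul_emul_apply_of_not_subset {L S : Finset (Fin 6)} (h : ¬ L ⊆ S)
    (I : Finset (Fin 6)) (i : Fin 6) :
    dE i (emul (emul (xiF L) (xiF {i})) (xiF I)) S = 0 := by
  rw [dE_emul_emul]
  split_ifs with hi
  · rw [Finsupp.single_apply, if_neg]
    rintro rfl
    refine h fun x hx => ?_
    have : x ≠ i := fun hxi => hi.1 (hxi ▸ hx)
    simp [this, hx]
  · rfl

/-- The terms `∂ᵢξ_{Lj} ⋆ η_I` are supported on sets containing `L \ {i}` and some `j ∉ L`. -/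
lemma emul_dE_emul_apply_eq_zero {L S : Finset (Fin 6)} (h : L = S ∨ ∀ i, ¬ L.erase i ⊆ S)
    (I : Finset (Fin 6)) {i j : Fin 6} (hij : i ≠ j) :
    emul (dE i (emul (xiF L) (xiF {j}))) (xiF I) S = 0 := by
  rw [emul_xiF]
  by_cases hj : j ∈ L
  · simp [hj, dE_zero, emul_zero_left]
  rw [if_pos (Finset.disjoint_singleton_right.mpr hj), dE_single]
  split_ifs with hi
  · rw [emul_single_xiF]
    split_ifs with hd
    · rw [Finsupp.single_apply, if_neg]
      intro he
      rcases h with rfl | h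
      · exact hj (he ▸ by simp [hij.symm])
      · refine h i fun x hx => he ▸ ?_
        simp only [Finset.mem_erase] at hx
        simp [hx.1, hx.2]
    · rfl
  · simp [emul_zero_left]

/-- The terms `∂ᵢξ_L ⋆ ∂ᵢη_I` do not meet the monomial `η_L`. -/
lemma emul_dE_dE_apply_self (L I : Finset (Fin 6)) (i : Fin 6) :
    emul (dE i (xiF L)) (dE i (xiF I)) L = 0 := by
  rw [xiF, xiF, dE_single, dE_single]
  by_cases hL : i ∈ L
  · by_cases hI : i ∈ I
    · rw [if_pos hL, if_pos hI, emul_single_single]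
      split_ifs with hd
      · rw [Finsupp.single_apply, if_neg]
        intro he
        rw [← he] at hL
        simp at hL
      · rfl
    · simp [hI, emul_zero_right]
  · simp [hL, emul_zero_left]

lemma dE_dE_xiF_of_card_le_one {L : Finset (Fin 6)} (hL : L.card ≤ 1) (r s : Fin 6) :
    dE r (dE s (xiF L)) = 0 := by
  rw [xiF, dE_single]
  split_ifs with hs
  · have : L.erase s = ∅ := by
      rw [← Finset.card_eq_zero, Finset.card_erase_of_mem hs]
      omega
    rw [this, dE_single]
    simp
  · exact dE_zero r

section Coefficients

variable (tact : Module.End ℂ F) (xact : Fin 6 → Fin 6 → Module.End ℂ F)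

lemma dualCoef1_apply_of_ne_zero (L I S : Finset (Fin 6)) (v : F) {n : ℕ} (hn : n ≠ 0) :
    dualCoef1 tact xact L I v (n, S) = 0 := by
  simp [dualCoef1, emb_apply, hn.symm, apply_ite (fun f : IndF F => f (n, S))]

lemma dualCoef0_apply_of_two_le (L I S : Finset (Fin 6)) (v : F) {n : ℕ} (hn : 2 ≤ n) :
    dualCoef0 xact L I v (n, S) = 0 := by
  have h0 : 0 ≠ n := by omega
  have h1 : 1 ≠ n := by omega
  simp [dualCoef0, emb_apply, h0, h1, apply_ite (fun f : IndF F => f (n, S))]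

lemma dualCoef0_apply_one (L I S : Finset (Fin 6)) (v : F) :
    dualCoef0 xact L I v (1, S) =
      sgnLI L I • ((L.card : ℂ) - 2) • emul (xiF L) (xiF I) S • v := by
  simp [dualCoef0, emb_apply, apply_ite (fun f : IndF F => f (1, S))]

lemma dualCoef0_apply_zero_of_card_le_one {L : Finset (Fin 6)} (hL : L.card ≤ 1)
    (I : Finset (Fin 6)) (v : F) :
    dualCoef0 xact L I v (0, L) = 0 := by
  simp [dualCoef0, emb_apply, emul_dE_dE_apply_self,
    dE_dE_xiF_of_card_le_one hL, emul_zero_left, apply_ite (fun f : IndF F => f (0, L))]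

lemma dualCoef1_apply_zero_self (L I : Finset (Fin 6)) (v : F) :
    dualCoef1 tact xact L I v (0, L) =
      if I = ∅ then sgnLI L ∅ • (tact v - (6 - L.card : ℂ) • v) else 0 := by
  have h3 : ∀ i j : Fin 6, (if i ≠ j then
      emb (emul (dE i (emul (xiF L) (xiF {j}))) (xiF I)) 0 (xact j i v) else 0) (0, L) = 0 := by
    intro i j
    split_ifs with hij
    · rw [emb_apply, if_pos rfl, emul_dE_emul_apply_eq_zero (Or.inl rfl) I hij, zero_smul]
    · rfl
  simp only [dualCoef1, Finsupp.smul_apply, Finsupp.add_apply, Finsupp.sub_apply,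
    Finsupp.finsetSum_apply, h3, emb_apply, if_true, emul_xiF_apply_self,
    dE_emul_emul_apply_self, Finset.sum_const_zero, smul_zero, add_zero, ← Finset.sum_smul]
  split_ifs with hI
  · have hc : (∑ i : Fin 6, if i ∈ L then (0 : ℂ) else (-1) ^ L.card) =
        (6 - L.card) * (-1) ^ L.card := by
      have h := Finset.card_compl_add_card L
      rw [Fintype.card_fin] at h
      have h' : ((Lᶜ.card : ℂ)) = 6 - L.card := by
        rw [eq_sub_iff_add_eq]; exact_mod_cast h
      rw [← h', Finset.sum_ite, Finset.sum_const_zero, zero_add, Finset.sum_const, nsmul_eq_mul,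
        Finset.compl_eq_univ_sdiff, ← Finset.filter_notMem_eq_sdiff]
    have hs : (-1 : ℂ) ^ L.card * ((6 - L.card) * (-1) ^ L.card) = 6 - L.card := by
      rw [mul_left_comm, ← mul_pow]; simp
    rw [hI, hc, smul_smul, hs, one_smul]
  · simp

lemma dualCoef1_apply_of_not_erase_subset {L S : Finset (Fin 6)}
    (h : ∀ i, ¬ L.erase i ⊆ S) (I : Finset (Fin 6)) (v : F) :
    dualCoef1 tact xact L I v (0, S) = 0 := by
  have hLS : ¬ L ⊆ S := fun hs => h 0 ((Finset.erase_subset 0 L).trans hs)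
  have h3 : ∀ i j : Fin 6, (if i ≠ j then
      emb (emul (dE i (emul (xiF L) (xiF {j}))) (xiF I)) 0 (xact j i v) else 0) (0, S) = 0 := by
    intro i j
    split_ifs with hij
    · rw [emb_apply, if_pos rfl, emul_dE_emul_apply_eq_zero (Or.inr h) I hij, zero_smul]
    · rfl
  simp only [dualCoef1, Finsupp.smul_apply, Finsupp.add_apply, Finsupp.sub_apply,
    Finsupp.finsetSum_apply, h3, emb_apply, if_true, emul_xiF_apply_of_not_subset hLS,
    dE_emul_emul_apply_of_not_subset hLS, Finset.sum_const_zero, smul_zero, zero_smul, add_zero,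
    sub_zero]

lemma dualAct_zero_apply (L S : Finset (Fin 6)) (w : IndF F) (n : ℕ) :
    dualAct tact xact L w 0 (n, S) =
      w.sum fun q v => if q.1 ≤ n then dualCoef0 xact L q.2 v (n - q.1, S) else 0 := by
  rw [dualAct, Finsupp.sum_apply]
  refine Finset.sum_congr rfl fun q _ => ?_
  simp [dualCoef, shiftTheta_apply]

lemma dualAct_one_apply (L S : Finset (Fin 6)) (w : IndF F) (n : ℕ) :
    dualAct tact xact L w 1 (n, S) =
      w.sum fun q v =>
        (q.1 : ℂ) • (if q.1 ≤ n + 1 then dualCoef0 xact L q.2 v (n + 1 - q.1, S) else 0) +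
          if q.1 = n then dualCoef1 tact xact L q.2 v (0, S) else 0 := by
  rw [dualAct, Finsupp.sum_apply]
  refine Finset.sum_congr rfl fun q _ => ?_
  obtain ⟨k, I⟩ := q
  have h1 : (if k ≤ n then dualCoef1 tact xact L I (w (k, I)) (n - k, S) else 0) =
      if k = n then dualCoef1 tact xact L I (w (k, I)) (0, S) else 0 := by
    rcases lt_trichotomy k n with h | rfl | h
    · rw [if_pos h.le, if_neg h.ne, dualCoef1_apply_of_ne_zero]
      omega
    · simp
    · rw [if_neg (by omega), if_neg (by omega)]
  rcases k with _ | k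
  · simpa [Finset.sum_range_succ, dualCoef, shiftTheta_apply] using h1
  · simpa [Finset.sum_range_succ, dualCoef, shiftTheta_apply] using h1

/-- The `Θᵏ`-part of the first `λ`-derivative, corrected by the value at `λ = 0`, only involves
the `Θᵏ`-part of `w`. -/
lemma dualAct_one_sub_dualAct_zero_apply (L S : Finset (Fin 6)) (w : IndF F) (k : ℕ) :
    dualAct tact xact L w 1 (k, S) - ((k : ℂ) + 1) • dualAct tact xact L w 0 (k + 1, S) =
      w.sum fun q v => if q.1 = k then
        dualCoef1 tact xact L q.2 v (0, S) - dualCoef0 xact L q.2 v (1, S) else 0 := by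
  rw [dualAct_one_apply, dualAct_zero_apply, Finsupp.sum, Finsupp.sum, Finsupp.sum,
    Finset.smul_sum, ← Finset.sum_sub_distrib]
  refine Finset.sum_congr rfl fun q _ => ?_
  obtain ⟨n, I⟩ := q
  dsimp only
  by_cases hn : n = k
  · subst hn
    simp only [if_pos (Nat.le_succ n), Nat.add_sub_cancel_left, if_true]
    module
  · rw [if_neg hn, if_neg hn, add_zero, ← sub_smul]
    split_ifs with hle
    · rcases Nat.lt_or_ge k n with h | h
      · obtain rfl : n = k + 1 := by omega
        simp
      · rw [dualCoef0_apply_of_two_le _ _ _ _ _ (by omega), smul_zero]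
    · rw [smul_zero]

lemma sum_ite_fst_ite_snd (w : IndF F) (k : ℕ) (f : F → F) (hf : f 0 = 0) :
    (w.sum fun q v => if q.1 = k then (if q.2 = ∅ then f v else 0) else 0) = f (w (k, ∅)) := by
  rw [Finsupp.sum, Finset.sum_eq_single (k, ∅)]
  · simp
  · rintro ⟨n, I⟩ _ hne
    by_cases hn : n = k
    · have : I ≠ ∅ := fun hI => hne (by rw [hn, hI])
      simp [this]
    · simp [hn]
  · intro h
    simp [Finsupp.notMem_support_iff.mp h, hf]

end Coefficients

lemma sgnLI_smul_eq_zero {L I : Finset (Fin 6)} {v : F} (h : sgnLI L I • v = 0) : v = 0 :=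
  (smul_eq_zero.mp h).resolve_left (pow_ne_zero _ (by norm_num))

/-- The condition S2 for `ξ_j` determines the eigenvalue of `t` on `v_{∅,k}` as `5 + k`. -/
lemma IsSingular.tact_eq_five_add {tact : Module.End ℂ F}
    {xact : Fin 6 → Fin 6 → Module.End ℂ F} {w : IndF F} (h : IsSingular tact xact w) (k : ℕ) :
    tact (w (k, ∅)) = (5 + k : ℂ) • w (k, ∅) := by
  set L : Finset (Fin 6) := {0} with hLdef
  have hL : L.card = 1 := rfl
  have h2 := DFunLike.congr_fun ((h L (by omega)).2.1 (by omega)) (k, L)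
  rw [singCond, if_neg (by omega), smul_zero, sub_zero] at h2
  have key : dualAct tact xact L w 1 (k, L) =
      sgnLI L ∅ • (tact (w (k, ∅)) - (5 : ℂ) • w (k, ∅) - (k : ℂ) • w (k, ∅)) := by
    rw [dualAct_one_apply, ← sum_ite_fst_ite_snd w k
      (fun v => sgnLI L ∅ • (tact v - (5 : ℂ) • v - (k : ℂ) • v)) (by simp)]
    refine Finset.sum_congr rfl fun q _ => ?_
    obtain ⟨n, I⟩ := q
    dsimp only
    by_cases hn : n = k
    · subst hn
      simp only [if_pos (Nat.le_succ n), Nat.add_sub_cancel_left, if_true,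
        dualCoef0_apply_one, dualCoef1_apply_zero_self, emul_xiF_apply_self, hL]
      split_ifs with hI
      · subst hI
        push_cast
        module
      · simp
    · rw [if_neg hn, if_neg hn, add_zero]
      split_ifs with hle
      · rcases Nat.lt_or_ge k n with h | h
        · obtain rfl : n = k + 1 := by omega
          rw [Nat.sub_self, dualCoef0_apply_zero_of_card_le_one _ hL.le, smul_zero]
        · rw [dualCoef0_apply_of_two_le _ _ _ _ _ (by omega), smul_zero]
      · rw [smul_zero]
  rw [key] at h2
  have h3 := sgnLI_smul_eq_zero h2
  rw [sub_sub, ← add_smul, sub_eq_zero] at h3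
  exact h3

/-- The conditions S2 and S3 for `ξ_{ijk}` determine the eigenvalue of `t` on `v_{∅,k}` as `4`. -/
lemma IsSingular.tact_eq_four {tact : Module.End ℂ F}
    {xact : Fin 6 → Fin 6 → Module.End ℂ F} {w : IndF F} (h : IsSingular tact xact w) (k : ℕ) :
    tact (w (k, ∅)) = (4 : ℂ) • w (k, ∅) := by
  set L : Finset (Fin 6) := {0, 1, 2} with hLdef
  have hL : L.card = 3 := rfl
  have hLc : ∀ i, ¬ Lᶜ.erase i ⊆ L := by rw [hLdef]; decide
  have h2 := DFunLike.congr_fun ((h L hL.le).2.1 (by omega)) (k, L)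
  have h3 := DFunLike.congr_fun ((h L hL.le).2.2 hL) (k + 1, L)
  rw [singCond, if_pos (by omega)] at h2 h3
  simp only [hL, Nat.sub_self, Nat.sub_zero, Finsupp.sub_apply, Finsupp.smul_apply,
    Finsupp.zero_apply] at h2 h3
  have hdual := dualAct_one_sub_dualAct_zero_apply tact xact Lᶜ L w k
  have hLc' : ¬ Lᶜ ⊆ L := fun hs => hLc 0 ((Finset.erase_subset 0 _).trans hs)
  simp only [dualCoef1_apply_of_not_erase_subset tact xact hLc, dualCoef0_apply_one,
    emul_xiF_apply_of_not_subset hLc', zero_smul, smul_zero, sub_zero, ite_self,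
    Finsupp.sum_fun_zero] at hdual
  have hself := dualAct_one_sub_dualAct_zero_apply tact xact L L w k
  have hsum : dualAct tact xact L w 1 (k, L) -
      ((k : ℂ) + 1) • dualAct tact xact L w 0 (k + 1, L) =
      sgnLI L ∅ • (tact (w (k, ∅)) - (4 : ℂ) • w (k, ∅)) := by
    rw [hself, ← sum_ite_fst_ite_snd w k
      (fun v => sgnLI L ∅ • (tact v - (4 : ℂ) • v)) (by simp)]
    refine Finset.sum_congr rfl fun q _ => ?_
    simp only [dualCoef0_apply_one, dualCoef1_apply_zero_self, emul_xiF_apply_self, hL]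
    split_ifs with hk hI
    · rw [hI]
      push_cast
      module
    · simp
    · rfl
  rw [sub_eq_zero] at h2 h3 hdual
  rw [h2, h3, hdual, smul_comm, sub_self] at hsum
  exact sub_eq_zero.mp (sgnLI_smul_eq_zero hsum.symm)

lemma eq_zero_of_smul_eq_smul {α β : ℂ} (hαβ : α ≠ β) {u v : F} (hα : u = α • v)
    (hβ : u = β • v) : v = 0 := by
  have h : (α - β) • v = 0 := by rw [sub_smul, ← hα, ← hβ, sub_self]
  exact (smul_eq_zero.mp h).resolve_left (sub_ne_zero.mpr hαβ)

theorem eigenvalue_equations_force_vanishing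
    {F : Type*} [AddCommGroup F] [Module ℂ F]
    (tact : Module.End ℂ F) (xact : Fin 6 → Fin 6 → Module.End ℂ F)
    (hF : IsG0Module F tact xact)
    (m : IndF F)
    (hsing : IsSingular tact xact (Tmap m)) :
    (tact (Tmap m (1, ∅)) = (6 : ℂ) • Tmap m (1, ∅) ∧
      tact (Tmap m (1, ∅)) = (4 : ℂ) • Tmap m (1, ∅) ∧
      Tmap m (1, ∅) = 0) ∧
    (tact (Tmap m (0, ∅)) = (5 : ℂ) • Tmap m (0, ∅) ∧
      tact (Tmap m (0, ∅)) = (4 : ℂ) • Tmap m (0, ∅) ∧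
      Tmap m (0, ∅) = 0) ∧
    (tact (Tmap m (2, ∅)) = (7 : ℂ) • Tmap m (2, ∅) ∧
      tact (Tmap m (2, ∅)) = (4 : ℂ) • Tmap m (2, ∅) ∧
      Tmap m (2, ∅) = 0) := by
  have h4 := hsing.tact_eq_four
  have h6 : tact (Tmap m (1, ∅)) = (6 : ℂ) • Tmap m (1, ∅) := by
    rw [hsing.tact_eq_five_add 1]; norm_num
  have h5 : tact (Tmap m (0, ∅)) = (5 : ℂ) • Tmap m (0, ∅) := by
    rw [hsing.tact_eq_five_add 0]; norm_num
  have h7 : tact (Tmap m (2, ∅)) = (7 : ℂ) • Tmap m (2, ∅) := by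
    rw [hsing.tact_eq_five_add 2]; norm_num
  exact ⟨⟨h6, h4 1, eq_zero_of_smul_eq_smul (by norm_num) h6 (h4 1)⟩,
    ⟨h5, h4 0, eq_zero_of_smul_eq_smul (by norm_num) h5 (h4 0)⟩,
    ⟨h7, h4 2, eq_zero_of_smul_eq_smul (by norm_num) h7 (h4 2)⟩⟩
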